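/- arXiv:2409.10002 — 2 statements merged into one kernel-verified Lean document; each statement's English description precedes it below -/
import Mathlib

section
/- Let X₁ ⊆ ℂ^n and X₂ ⊆ ℂ^m be open sets, and let φ₁ and φ₂ be weights on X₁ and X₂ respectively, each satisfying the evaluation bound. Let {g_τ}_{τ∈T} (T a countable index set) be an orthonormal and complete family in A²(X₂,φ₂). Then every f ∈ A²(X₁×X₂,φ₁φ₂) admits the expansion f = Σ_{τ∈T} f_τ·g_τ, where the coefficient functions f_τ(z) := ∫_{X₂} f(z,u)·conj(g_τ(u))·φ₂(u) dλ(u) satisfy: each f_τ belongs to A²(X₁,φ₁), the series Σ_{τ∈T} f_τ(z)g_τ(u) converges to f in the norm ‖·‖_{X₁×X₂,φ₁φ₂}, and Parseval's identity holds: ‖f‖²_{X₁×X₂,φ₁φ₂} = Σ_{τ∈T} ‖f_τ‖²_{X₁,φ₁}. -/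
open MeasureTheory

noncomputable section
/-- `f` belongs to the weighted Bergman space `A²(X, μ)`: it is holomorphic on `X` and
`|f|² μ` is integrable on `X`. -/
def MemA2 {E : Type*} [NormedAddCommGroup E] [NormedSpace ℂ E] [MeasureSpace E]
    (X : Set E) (μ : E → ℝ) (f : E → ℂ) : Prop :=
  DifferentiableOn ℂ f X ∧ IntegrableOn (fun x => ‖f x‖ ^ 2 * μ x) X volume

/-- The squared norm `‖f‖²_{X,μ} = ∫_X |f|² μ dλ`. -/
def normSqA2 {E : Type*} [NormedAddCommGroup E] [NormedSpace ℂ E] [MeasureSpace E]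
    (X : Set E) (μ : E → ℝ) (f : E → ℂ) : ℝ :=
  ∫ x in X, ‖f x‖ ^ 2 * μ x

/-- The inner product `⟨f,g⟩_{X,μ} = ∫_X f ·conj(g)· μ dλ`. -/
def innerA2 {E : Type*} [NormedAddCommGroup E] [NormedSpace ℂ E] [MeasureSpace E]
    (X : Set E) (μ : E → ℝ) (f g : E → ℂ) : ℂ :=
  ∫ x in X, f x * (starRingEnd ℂ) (g x) * (μ x : ℂ)

/-- `μ` is a weight on `X`: measurable and positive a.e. on `X`. -/
def IsWeight {E : Type*} [NormedAddCommGroup E] [NormedSpace ℂ E] [MeasureSpace E]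
    (X : Set E) (μ : E → ℝ) : Prop :=
  Measurable μ ∧ ∀ᵐ x ∂(volume.restrict X), 0 < μ x

/-- The weight `μ` on `X` satisfies the evaluation bound. -/
def EvalBound {E : Type*} [NormedAddCommGroup E] [NormedSpace ℂ E] [MeasureSpace E]
    (X : Set E) (μ : E → ℝ) : Prop :=
  ∀ K : Set E, K ⊆ X → IsCompact K → ∃ C : ℝ, ∀ f : E → ℂ, MemA2 X μ f →
    ∀ z ∈ K, ‖f z‖ ^ 2 ≤ C * normSqA2 X μ f

/-- The product weight `(φ₁φ₂)(z₁,z₂) = φ₁(z₁)·φ₂(z₂)`. -/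
def prodWeight {F G : Type*} (φ₁ : F → ℝ) (φ₂ : G → ℝ) : F × G → ℝ :=
  fun p => φ₁ p.1 * φ₂ p.2


theorem aux_dist_bound {E : Type*} [NormedAddCommGroup E] [NormedSpace ℂ E]
    {h : E → ℂ} {c : E} {r B : ℝ}
    (hB : ∀ z ∈ Metric.ball c r, ‖h z‖ ≤ B) (hr : 0 < r) :
    Set.MapsTo h (Metric.ball c r) (Metric.closedBall (h c) (2 * B)) := by
  intro z hz
  rw [Metric.mem_closedBall, dist_eq_norm]
  have h1 := hB z hz
  have h2 := hB c (Metric.mem_ball_self hr)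
  have h3 := norm_sub_le (h z) (h c)
  linarith

theorem aux_holo_integral {n : ℕ} {α : Type*} [MeasurableSpace α] {μ : Measure α}
    {X : Set (Fin n → ℂ)} (hX : IsOpen X) {F : (Fin n → ℂ) → α → ℂ}
    (hdiff : ∀ᵐ u ∂μ, DifferentiableOn ℂ (fun z => F z u) X)
    (hmeas : ∀ z ∈ X, AEStronglyMeasurable (F z) μ)
    (hbd : ∀ K : Set (Fin n → ℂ), K ⊆ X → IsCompact K → ∃ b : α → ℝ, Integrable b μ ∧
      ∀ᵐ u ∂μ, ∀ z ∈ K, ‖F z u‖ ≤ b u) :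
    DifferentiableOn ℂ (fun z => ∫ u, F z u ∂μ) X := by
  intro x₀ hx₀
  apply DifferentiableAt.differentiableWithinAt
  obtain ⟨r, hr, hrX⟩ := Metric.nhds_basis_closedBall.mem_iff.1 (hX.mem_nhds hx₀)
  obtain ⟨b, hb, hFb⟩ := hbd _ hrX (isCompact_closedBall x₀ r)
  have hdiff0 : ∀ᵐ u ∂μ, HasFDerivAt (fun z => F z u) (fderiv ℂ (fun z => F z u) x₀) x₀ := by
    filter_upwards [hdiff] with u hu
    exact ((hu x₀ hx₀).differentiableAt (hX.mem_nhds hx₀)).hasFDerivAt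
  have hpart : ∀ v : Fin n → ℂ,
      AEStronglyMeasurable (fun u => fderiv ℂ (fun z => F z u) x₀ v) μ := by
    intro v
    have ht : Filter.Tendsto (fun k : ℕ => x₀ + ((k : ℂ))⁻¹ • v) Filter.atTop (nhds x₀) := by
      have h0 : Filter.Tendsto (fun k : ℕ => ((k : ℂ))⁻¹) Filter.atTop (nhds 0) :=
        tendsto_inv_atTop_nhds_zero_nat (𝕜 := ℂ)
      have := (h0.smul_const v).const_add x₀
      simpa using this
    obtain ⟨N, hN⟩ := Filter.eventually_atTop.1 (ht.eventually (hX.mem_nhds hx₀))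
    refine aestronglyMeasurable_of_tendsto_ae Filter.atTop
      (f := fun (k : ℕ) u => ((k + N : ℕ) : ℂ) • (F (x₀ + (((k + N : ℕ) : ℂ))⁻¹ • v) u - F x₀ u))
      ?_ ?_
    · intro k
      exact ((hmeas _ (hN _ (Nat.le_add_left _ _))).sub (hmeas _ hx₀)).const_smul ((k + N : ℕ) : ℂ)
    · filter_upwards [hdiff0] with u hu
      have hc : Filter.Tendsto (fun k : ℕ => ‖((k + N : ℕ) : ℂ)‖) Filter.atTop Filter.atTop := by
        simp only [Complex.norm_natCast]
        exact tendsto_natCast_atTop_atTop.comp (Filter.tendsto_add_atTop_nat N)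
      exact hu.lim v hc
  have hF'meas : AEStronglyMeasurable (fun u => fderiv ℂ (fun z => F z u) x₀) μ := by
    have : (fun u => fderiv ℂ (fun z => F z u) x₀) = fun u => ∑ i : Fin n,
        (fderiv ℂ (fun z => F z u) x₀ (Pi.single i 1)) •
          (ContinuousLinearMap.proj i : (Fin n → ℂ) →L[ℂ] ℂ) := by
      funext u
      ext v
      conv_lhs => rw [← Finset.univ_sum_single v]
      rw [map_sum]
      simp only [_root_.sum_apply, _root_.smul_apply,
        ContinuousLinearMap.proj_apply, smul_eq_mul]
      refine Finset.sum_congr rfl fun i _ => ?_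
      have : (Pi.single i (v i) : Fin n → ℂ) = v i • Pi.single i 1 := by
        rw [← Pi.single_smul]; simp
      rw [this, map_smul, smul_eq_mul, mul_comm]
    rw [this]
    refine Finset.aestronglyMeasurable_fun_sum _ fun i _ => ?_
    exact (hpart _).smul_const _
  refine (hasFDerivAt_integral_of_dominated_loc_of_lip' (Metric.ball_mem_nhds x₀ hr)
    (F := F) (F' := fun u => fderiv ℂ (fun z => F z u) x₀) (bound := fun u => 2 * b u / r)
    ?_ ?_ hF'meas ?_ ?_ hdiff0).2.differentiableAt
  · intro z hz
    exact hmeas z (hrX (Metric.ball_subset_closedBall hz))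
  · refine hb.mono' (hmeas _ hx₀) ?_
    filter_upwards [hFb] with u hu
    exact hu _ (Metric.mem_closedBall_self hr.le)
  · filter_upwards [hFb, hdiff] with u hu hd x hx
    have hd' := hd.mono (Metric.ball_subset_closedBall.trans hrX)
    have := Complex.dist_le_div_mul_dist_of_mapsTo_ball hd' (aux_dist_bound
      (fun z hz => hu z (Metric.ball_subset_closedBall hz)) hr) hx
    simpa [dist_eq_norm] using this
  · exact (hb.const_mul 2).div_const r

theorem aux_holo_limit {E : Type*} [NormedAddCommGroup E] [NormedSpace ℂ E] [ProperSpace E]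
    {X : Set E} (hX : IsOpen X) {F : ℕ → E → ℂ} (hF : ∀ k, DifferentiableOn ℂ (F k) X)
    (hC : ∀ K : Set E, K ⊆ X → IsCompact K → UniformCauchySeqOn F Filter.atTop K) :
    ∃ S : E → ℂ, DifferentiableOn ℂ S X ∧
      ∀ z ∈ X, Filter.Tendsto (fun k => F k z) Filter.atTop (nhds (S z)) := by
  have hlim : ∀ z, ∃ y, z ∈ X → Filter.Tendsto (fun k => F k z) Filter.atTop (nhds y) := by
    intro z
    by_cases hz : z ∈ X
    · have := (hC {z} (by simpa using hz) isCompact_singleton).cauchySeq (Set.mem_singleton z)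
      obtain ⟨y, hy⟩ := cauchySeq_tendsto_of_complete this
      exact ⟨y, fun _ => hy⟩
    · exact ⟨0, fun h => absurd h hz⟩
  choose S hS using hlim
  refine ⟨S, ?_, hS⟩
  intro x₀ hx₀
  apply DifferentiableAt.differentiableWithinAt
  obtain ⟨R, hR, hRX⟩ := Metric.nhds_basis_closedBall.mem_iff.1 (hX.mem_nhds hx₀)
  obtain ⟨r, hr, rfl⟩ : ∃ r, 0 < r ∧ R = 2 * r := ⟨R / 2, by linarith, by ring⟩
  have hsub : ∀ y ∈ Metric.ball x₀ r, Metric.ball y r ⊆ Metric.closedBall x₀ (2 * r) := by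
    intro y hy z hz
    rw [Metric.mem_ball] at hy hz
    rw [Metric.mem_closedBall]
    linarith [dist_triangle z y x₀]
  have hballX : Metric.ball x₀ r ⊆ X := (Metric.ball_subset_closedBall.trans
    (Metric.closedBall_subset_closedBall (by linarith))).trans hRX
  have hdF : ∀ k, ∀ y ∈ X, DifferentiableAt ℂ (F k) y := fun k y hy =>
    (hF k y hy).differentiableAt (hX.mem_nhds hy)
  have hUC : UniformCauchySeqOn (fun k => fderiv ℂ (F k)) Filter.atTop (Metric.ball x₀ r) := by
    have h := hC _ hRX (isCompact_closedBall _ _)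
    rw [Metric.uniformCauchySeqOn_iff] at h ⊢
    intro ε hε
    obtain ⟨N, hN⟩ := h (ε * r / 4) (by positivity)
    refine ⟨N, fun k hk l hl y hy => ?_⟩
    rw [dist_eq_norm, ← fderiv_sub (hdF k y (hballX hy)) (hdF l y (hballX hy))]
    have hd : DifferentiableOn ℂ (F k - F l) (Metric.ball y r) :=
      ((hF k).sub (hF l)).mono ((hsub y hy).trans hRX)
    have := Complex.norm_fderiv_le_div_of_mapsTo_ball hd (aux_dist_bound (B := ε * r / 4)
      (fun z hz => by
        have := hN k hk l hl z (hsub y hy hz)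
        rw [dist_eq_norm] at this
        exact this.le) hr) hr
    refine this.trans_lt ?_
    rw [div_lt_iff₀ hr]
    nlinarith [mul_pos hε hr]
  have hg' : ∀ y, ∃ L : E →L[ℂ] ℂ, y ∈ Metric.ball x₀ r →
      Filter.Tendsto (fun k => fderiv ℂ (F k) y) Filter.atTop (nhds L) := by
    intro y
    by_cases hy : y ∈ Metric.ball x₀ r
    · obtain ⟨L, hL⟩ := cauchySeq_tendsto_of_complete (hUC.cauchySeq hy)
      exact ⟨L, fun _ => hL⟩
    · exact ⟨0, fun h => absurd h hy⟩
  choose G hG using hg'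
  exact (hasFDerivAt_of_tendstoUniformlyOn Metric.isOpen_ball
    (hUC.tendstoUniformlyOn_of_tendsto hG) (fun k y hy => (hdF k y (hballX hy)).hasFDerivAt)
    (fun y hy => hS y (hballX hy)) (Metric.mem_ball_self hr)).differentiableAt

/-- The measure `φ dλ` on `X`. -/
def nuW {E : Type*} [MeasureSpace E] (X : Set E) (φ : E → ℝ) : Measure E :=
  (volume.restrict X).withDensity (fun x => ((φ x).toNNReal : ENNReal))

instance nuW_sfinite {E : Type*} [MeasureSpace E] [SFinite (volume : Measure E)]
    (X : Set E) (φ : E → ℝ) : SFinite (nuW X φ) := by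
  unfold nuW; infer_instance

section nu
variable {E : Type*} [NormedAddCommGroup E] [NormedSpace ℂ E] [MeasureSpace E]
  {X : Set E} {φ : E → ℝ}

theorem nuW_integral_complex (hw : IsWeight X φ) (h : E → ℂ) :
    ∫ x in X, h x * (φ x : ℂ) = ∫ x, h x ∂(nuW X φ) := by
  unfold nuW
  rw [integral_withDensity_eq_integral_smul hw.1.real_toNNReal]
  refine integral_congr_ae ?_
  filter_upwards [hw.2] with x hx
  rw [NNReal.smul_def, Real.coe_toNNReal _ hx.le, Complex.real_smul, mul_comm]

theorem nuW_integral_real (hw : IsWeight X φ) (h : E → ℝ) :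
    ∫ x in X, h x * φ x = ∫ x, h x ∂(nuW X φ) := by
  unfold nuW
  rw [integral_withDensity_eq_integral_smul hw.1.real_toNNReal]
  refine integral_congr_ae ?_
  filter_upwards [hw.2] with x hx
  rw [NNReal.smul_def, Real.coe_toNNReal _ hx.le, smul_eq_mul, mul_comm]

theorem nuW_integrable (hw : IsWeight X φ) (h : E → ℝ) :
    IntegrableOn (fun x => h x * φ x) X volume ↔ Integrable h (nuW X φ) := by
  unfold nuW
  rw [integrable_withDensity_iff_integrable_smul hw.1.real_toNNReal]
  refine integrable_congr ?_
  filter_upwards [hw.2] with x hx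
  rw [NNReal.smul_def, Real.coe_toNNReal _ hx.le, smul_eq_mul, mul_comm]

theorem nuW_normSq (hw : IsWeight X φ) (h : E → ℂ) :
    normSqA2 X φ h = ∫ x, ‖h x‖ ^ 2 ∂(nuW X φ) := nuW_integral_real hw _

theorem nuW_inner (hw : IsWeight X φ) (h k : E → ℂ) :
    innerA2 X φ h k = ∫ x, h x * (starRingEnd ℂ) (k x) ∂(nuW X φ) := nuW_integral_complex hw _

theorem nuW_mem (hw : IsWeight X φ) (h : E → ℂ) :
    MemA2 X φ h ↔ DifferentiableOn ℂ h X ∧ Integrable (fun x => ‖h x‖ ^ 2) (nuW X φ) := by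
  unfold MemA2; rw [nuW_integrable hw]

theorem nuW_ac : nuW X φ ≪ volume.restrict X := withDensity_absolutelyContinuous _ _

theorem nuW_ac' (hw : IsWeight X φ) : volume.restrict X ≪ nuW X φ := by
  unfold nuW
  refine withDensity_absolutelyContinuous' ?_ ?_
  · exact hw.1.real_toNNReal.coe_nnreal_ennreal.aemeasurable
  · filter_upwards [hw.2] with x hx
    simpa using hx

theorem nuW_ae_mem [OpensMeasurableSpace E] (hX : IsOpen X) : ∀ᵐ x ∂(nuW X φ), x ∈ X :=
  nuW_ac.ae_le (ae_restrict_mem hX.measurableSet)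

theorem nuW_meas [OpensMeasurableSpace E] [SecondCountableTopology E] (hX : IsOpen X) {h : E → ℂ}
    (hd : ContinuousOn h X) : AEStronglyMeasurable h (nuW X φ) :=
  (hd.aestronglyMeasurable hX.measurableSet).mono_ac nuW_ac

theorem nuW_memLp [OpensMeasurableSpace E] [SecondCountableTopology E] (hX : IsOpen X)
    (hw : IsWeight X φ) {h : E → ℂ} (hh : MemA2 X φ h) : MemLp h 2 (nuW X φ) :=
  (memLp_two_iff_integrable_sq_norm (nuW_meas hX hh.1.continuousOn)).2 ((nuW_mem hw h).1 hh).2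

theorem aux_inner_toLp {α : Type*} [MeasurableSpace α] {μ : Measure α} {a b : α → ℂ}
    (ha : MemLp a 2 μ) (hb : MemLp b 2 μ) :
    inner ℂ (ha.toLp a) (hb.toLp b) = ∫ x, b x * (starRingEnd ℂ) (a x) ∂μ := by
  rw [L2.inner_def]
  refine integral_congr_ae ?_
  filter_upwards [ha.coeFn_toLp, hb.coeFn_toLp] with x hx hy
  rw [hx, hy]; rfl

theorem aux_norm_toLp {α : Type*} [MeasurableSpace α] {μ : Measure α} {a : α → ℂ}
    (ha : MemLp a 2 μ) :
    ‖ha.toLp a‖ ^ 2 = ∫ x, ‖a x‖ ^ 2 ∂μ := by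
  have h1 := inner_self_eq_norm_sq_to_K (𝕜 := ℂ) (ha.toLp a)
  rw [aux_inner_toLp] at h1
  have h2 : ∀ x, a x * (starRingEnd ℂ) (a x) = ((‖a x‖ ^ 2 : ℝ) : ℂ) := fun x => by
    rw [Complex.mul_conj, Complex.normSq_eq_norm_sq]
  simp only [h2] at h1
  rw [integral_complex_ofReal] at h1
  have h3 : ((∫ x, ‖a x‖ ^ 2 ∂μ : ℝ) : ℂ) = ((‖ha.toLp a‖ ^ 2 : ℝ) : ℂ) := by
    rw [h1]; push_cast; rfl
  exact (Complex.ofReal_injective h3).symm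

/-- The space `A²(X, φ)` as a subspace of `L²`. -/
def a2Sub [OpensMeasurableSpace E] [SecondCountableTopology E] (hX : IsOpen X)
    (hw : IsWeight X φ) : Submodule ℂ (Lp ℂ 2 (nuW X φ)) where
  carrier := {y | ∃ S : E → ℂ, ∃ hS : MemA2 X φ S, (nuW_memLp hX hw hS).toLp S = y}
  zero_mem' := by
    have h0 : MemA2 X φ (fun _ => 0) := ⟨differentiableOn_const _, by simp⟩
    exact ⟨_, h0, MemLp.toLp_zero _⟩
  add_mem' := by
    rintro _ _ ⟨S, hS, rfl⟩ ⟨S', hS', rfl⟩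
    have hm := (nuW_memLp hX hw hS).add (nuW_memLp hX hw hS')
    have : MemA2 X φ (S + S') := (nuW_mem hw _).2 ⟨hS.1.add hS'.1,
      (memLp_two_iff_integrable_sq_norm hm.1).1 hm⟩
    exact ⟨_, this, MemLp.toLp_add _ _⟩
  smul_mem' := by
    rintro c _ ⟨S, hS, rfl⟩
    have hm := (nuW_memLp hX hw hS).const_smul c
    have : MemA2 X φ (c • S) := (nuW_mem hw _).2 ⟨hS.1.const_smul c,
      (memLp_two_iff_integrable_sq_norm hm.1).1 hm⟩
    exact ⟨_, this, MemLp.toLp_const_smul _ _⟩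

theorem MemA2_sub' [OpensMeasurableSpace E] [SecondCountableTopology E] (hX : IsOpen X)
    (hw : IsWeight X φ) {S S' : E → ℂ} (hS : MemA2 X φ S) (hS' : MemA2 X φ S') :
    MemA2 X φ (S - S') := by
  have hm := (nuW_memLp hX hw hS).sub (nuW_memLp hX hw hS')
  exact (nuW_mem hw _).2 ⟨hS.1.sub hS'.1, (memLp_two_iff_integrable_sq_norm hm.1).1 hm⟩

theorem a2Sub_closed [OpensMeasurableSpace E] [SecondCountableTopology E] [ProperSpace E]
    (hX : IsOpen X) (hw : IsWeight X φ) (he : EvalBound X φ) :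
    IsClosed (a2Sub hX hw : Set (Lp ℂ 2 (nuW X φ))) := by
  apply IsSeqClosed.isClosed
  intro Y y hY hy
  choose F hF hFY using hY
  have hnorm : ∀ k l, normSqA2 X φ (F k - F l) = dist (Y k) (Y l) ^ 2 := by
    intro k l
    rw [dist_eq_norm, ← hFY k, ← hFY l, ← MemLp.toLp_sub, aux_norm_toLp, nuW_normSq hw]
  have hCau := hy.cauchySeq
  obtain ⟨S, hSd, hSlim⟩ := aux_holo_limit hX (fun k => (hF k).1) (by
    intro K hK hKc
    obtain ⟨C, hC⟩ := he K hK hKc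
    rw [Metric.uniformCauchySeqOn_iff]
    intro ε hε
    obtain ⟨N, hN⟩ := Metric.cauchySeq_iff.1 hCau (ε / Real.sqrt (|C| + 1)) (by positivity)
    refine ⟨N, fun k hk l hl z hz => ?_⟩
    have h1 := hC _ (MemA2_sub' hX hw (hF k) (hF l)) z hz
    rw [hnorm] at h1
    have h2 := hN k hk l hl
    rw [lt_div_iff₀ (by positivity)] at h2
    rw [dist_eq_norm]
    refine lt_of_pow_lt_pow_left₀ 2 hε.le ?_
    have h3 : (dist (Y k) (Y l) * Real.sqrt (|C| + 1)) ^ 2 < ε ^ 2 :=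
      pow_lt_pow_left₀ h2 (by positivity) (by norm_num)
    rw [mul_pow, Real.sq_sqrt (by positivity)] at h3
    refine lt_of_le_of_lt (h1.trans ?_) h3
    nlinarith [le_abs_self C, sq_nonneg (dist (Y k) (Y l))])
  have hae : S =ᵐ[nuW X φ] y := by
    obtain ⟨ns, hns, hlim⟩ := (tendstoInMeasure_of_tendsto_Lp hy).exists_seq_tendsto_ae
    have hcoe : ∀ᵐ x ∂(nuW X φ), ∀ k, (Y k) x = F k x := by
      rw [ae_all_iff]
      intro k
      rw [← hFY k]
      exact MemLp.coeFn_toLp _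
    filter_upwards [hlim, hcoe, nuW_ae_mem hX] with x h1 h2 h3
    simp only [h2] at h1
    exact tendsto_nhds_unique ((hSlim x h3).comp hns.tendsto_atTop) h1
  have hSm : MemLp S 2 (nuW X φ) := (memLp_congr_ae hae).2 (Lp.memLp y)
  have hSA : MemA2 X φ S :=
    (nuW_mem hw _).2 ⟨hSd, (memLp_two_iff_integrable_sq_norm hSm.1).1 hSm⟩
  refine ⟨S, hSA, ?_⟩
  apply Lp.ext
  exact (MemLp.coeFn_toLp _).trans hae

theorem aux_expansion [OpensMeasurableSpace E] [SecondCountableTopology E] [ProperSpace E]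
    (hX : IsOpen X) (hw : IsWeight X φ) (he : EvalBound X φ)
    {T : Type*} [DecidableEq T] (g : T → E → ℂ)
    (hgmem : ∀ τ, MemA2 X φ (g τ))
    (hgon : ∀ τ σ, innerA2 X φ (g τ) (g σ) = if τ = σ then 1 else 0)
    (hgcomp : ∀ h : E → ℂ, MemA2 X φ h →
      (∀ τ, innerA2 X φ h (g τ) = 0) → ∀ w ∈ X, h w = 0)
    (h : E → ℂ) (hh : MemA2 X φ h) :
    HasSum (fun τ => ‖innerA2 X φ h (g τ)‖ ^ 2) (normSqA2 X φ h) ∧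
    ∀ s : Finset T, normSqA2 X φ (fun u => h u - ∑ τ ∈ s, innerA2 X φ h (g τ) * g τ u)
      = normSqA2 X φ h - ∑ τ ∈ s, ‖innerA2 X φ h (g τ)‖ ^ 2 := by
  set G : T → Lp ℂ 2 (nuW X φ) := fun τ => (nuW_memLp hX hw (hgmem τ)).toLp (g τ) with hG
  set x := (nuW_memLp hX hw hh).toLp h with hx
  have hGi : ∀ (k : E → ℂ) (hk : MemA2 X φ k) τ,
      inner ℂ (G τ) ((nuW_memLp hX hw hk).toLp k) = innerA2 X φ k (g τ) := by
    intro k hk τ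
    rw [hG, aux_inner_toLp, nuW_inner hw]
  have hon : Orthonormal ℂ G := by
    rw [orthonormal_iff_ite]
    intro i j
    rw [hGi _ (hgmem j), hgon]
    simp [eq_comm]
  have hxn : ‖x‖ ^ 2 = normSqA2 X φ h := by rw [hx, aux_norm_toLp, nuW_normSq hw]
  have hc : ∀ τ, inner ℂ (G τ) x = innerA2 X φ h (g τ) := hGi h hh
  have hsummable : Summable (fun τ => inner ℂ (G τ) x • G τ) := by
    have := (hon.orthogonalFamily.summable_iff_norm_sq_summable
      (fun τ => inner ℂ (G τ) x)).2 (hon.inner_products_summable x)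
    simpa using this
  obtain ⟨y, hy⟩ := hsummable
  have hyA : y ∈ a2Sub hX hw := by
    refine (a2Sub_closed hX hw he).mem_of_tendsto hy (Filter.Eventually.of_forall fun s => ?_)
    exact Submodule.sum_mem _ fun τ _ => Submodule.smul_mem _ _ ⟨_, hgmem τ, rfl⟩
  have hyi : ∀ τ, inner ℂ (G τ) y = inner ℂ (G τ) x := by
    intro τ
    have h1 := hy.mapL (innerSL ℂ (G τ))
    have h2 : HasSum (fun σ => innerSL ℂ (G τ) (inner ℂ (G σ) x • G σ)) (inner ℂ (G τ) x) := by
      have := hasSum_ite_eq τ (inner ℂ (G τ) x)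
      refine this.congr_fun ?_
      intro σ
      simp only [innerSL_apply_apply, inner_smul_right, (orthonormal_iff_ite.1 hon) τ σ]
      by_cases hs : σ = τ
      · simp [hs]
      · simp [hs, Ne.symm hs]
    exact h1.unique h2
  obtain ⟨S, hS, hSy⟩ := hyA
  have hD := hgcomp _ (MemA2_sub' hX hw hh hS) (fun τ => by
    rw [← hGi _ (MemA2_sub' hX hw hh hS),
      MemLp.toLp_sub (nuW_memLp hX hw hh) (nuW_memLp hX hw hS), hSy, inner_sub_right, hyi]
    simp [hx])
  have hxy : x = y := by
    rw [← hSy]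
    refine MemLp.toLp_congr _ _ ?_
    filter_upwards [nuW_ae_mem hX] with u hu
    exact sub_eq_zero.1 (hD u hu)
  rw [← hxy] at hy
  refine ⟨?_, ?_⟩
  · have h1 := hy.mapL (innerSL ℂ x)
    have h2 := h1.mapL Complex.reCLM
    have e1 : Complex.reCLM (innerSL ℂ x x) = normSqA2 X φ h := by
      rw [← hxn]
      exact inner_self_eq_norm_sq (𝕜 := ℂ) x
    rw [e1] at h2
    refine h2.congr_fun fun τ => ?_
    rw [← hc τ]
    simp only [innerSL_apply_apply, inner_smul_right]
    rw [← inner_conj_symm x (G τ), Complex.mul_conj, Complex.normSq_eq_norm_sq]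
    exact (Complex.ofReal_re _).symm
  · intro s
    have hm : MemLp (fun u => ∑ τ ∈ s, innerA2 X φ h (g τ) * g τ u) 2 (nuW X φ) :=
      memLp_finsetSum _ fun τ _ => (nuW_memLp hX hw (hgmem τ)).const_mul _
    have e1 : hm.toLp _ = ∑ τ ∈ s, inner ℂ (G τ) x • G τ := by
      apply Lp.ext
      refine hm.coeFn_toLp.trans ?_
      refine Filter.EventuallyEq.symm ((Lp.coeFn_fun_finsetSum s
        (fun τ => inner ℂ (G τ) x • G τ)).trans ?_)
      have hall : ∀ᵐ u ∂(nuW X φ), ∀ τ ∈ s, (inner ℂ (G τ) x • G τ) u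
          = innerA2 X φ h (g τ) * g τ u := by
        rw [Filter.eventually_all_finset]
        intro τ _
        filter_upwards [Lp.coeFn_smul (inner ℂ (G τ) x) (G τ),
          (nuW_memLp hX hw (hgmem τ)).coeFn_toLp] with u h1 h2
        rw [h1, Pi.smul_apply, h2, smul_eq_mul, hc]
      filter_upwards [hall] with u hu
      exact Finset.sum_congr rfl hu
    rw [nuW_normSq hw, ← hxn]
    have e2 := aux_norm_toLp ((nuW_memLp hX hw hh).sub hm)
    rw [MemLp.toLp_sub (nuW_memLp hX hw hh) hm, e1] at e2
    refine Eq.trans e2.symm ?_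
    simp only [← hc]
    rw [← hx, @norm_sub_sq ℂ]
    have h3 : inner ℂ x (∑ τ ∈ s, inner ℂ (G τ) x • G τ) =
        ((∑ τ ∈ s, ‖inner ℂ (G τ) x‖ ^ 2 : ℝ) : ℂ) := by
      rw [inner_sum]
      push_cast
      refine Finset.sum_congr rfl fun τ _ => ?_
      rw [inner_smul_right, ← inner_conj_symm x (G τ), Complex.mul_conj,
        Complex.normSq_eq_norm_sq]
      push_cast; rfl
    have h4 : ‖∑ τ ∈ s, inner ℂ (G τ) x • G τ‖ ^ 2 = ∑ τ ∈ s, ‖inner ℂ (G τ) x‖ ^ 2 := by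
      have := hon.orthogonalFamily.norm_sum (fun τ => inner ℂ (G τ) x) s
      simpa using this
    rw [h3, h4]
    have : RCLike.re (((∑ τ ∈ s, ‖inner ℂ (G τ) x‖ ^ 2 : ℝ) : ℂ)) =
      ∑ τ ∈ s, ‖inner ℂ (G τ) x‖ ^ 2 := Complex.ofReal_re _
    rw [this]; ring

end nu

theorem prodWeight_isWeight {n m : ℕ} {X₁ : Set (Fin n → ℂ)} {X₂ : Set (Fin m → ℂ)}
    {φ₁ : (Fin n → ℂ) → ℝ} {φ₂ : (Fin m → ℂ) → ℝ}
    (hw₁ : IsWeight X₁ φ₁) (hw₂ : IsWeight X₂ φ₂) :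
    IsWeight (X₁ ×ˢ X₂) (prodWeight φ₁ φ₂) ∧
      nuW (X₁ ×ˢ X₂) (prodWeight φ₁ φ₂) = (nuW X₁ φ₁).prod (nuW X₂ φ₂) := by
  have hr : (volume : Measure ((Fin n → ℂ) × (Fin m → ℂ))).restrict (X₁ ×ˢ X₂) =
      (volume.restrict X₁).prod (volume.restrict X₂) := by
    rw [Measure.prod_restrict]; rfl
  have hp1 : ∀ᵐ p ∂((volume.restrict X₁).prod (volume.restrict X₂)), 0 < φ₁ p.1 :=
    Measure.quasiMeasurePreserving_fst.ae hw₁.2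
  have hp2 : ∀ᵐ p ∂((volume.restrict X₁).prod (volume.restrict X₂)), 0 < φ₂ p.2 :=
    Measure.quasiMeasurePreserving_snd.ae hw₂.2
  refine ⟨⟨(hw₁.1.comp measurable_fst).mul (hw₂.1.comp measurable_snd), ?_⟩, ?_⟩
  · rw [hr]
    filter_upwards [hp1, hp2] with p h1 h2
    exact mul_pos h1 h2
  · unfold nuW
    rw [prod_withDensity hw₁.1.real_toNNReal.coe_nnreal_ennreal
      hw₂.1.real_toNNReal.coe_nnreal_ennreal, hr]
    refine withDensity_congr_ae ?_
    filter_upwards [hp1, hp2] with p h1 h2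
    simp only [prodWeight]
    rw [Real.toNNReal_mul h1.le]
    push_cast; rfl

set_option maxHeartbeats 400000 in
/-- expansion of `f ∈ A²(X₁×X₂, φ₁φ₂)` along a complete orthonormal family
`{g_τ}` of `A²(X₂,φ₂)`: the coefficient functions
`f_τ(z) = ∫_{X₂} f(z,u)·conj(g_τ(u))·φ₂(u) dλ(u)` lie in `A²(X₁,φ₁)`, the series
`Σ_τ f_τ(z)g_τ(u)` converges to `f` in the `A²(X₁×X₂,φ₁φ₂)` norm, and Parseval's identity
`‖f‖² = Σ_τ ‖f_τ‖²` holds. -/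
theorem product_expansion_along_basis {n m : ℕ} {T : Type*} [Countable T] [DecidableEq T]
    (X₁ : Set (Fin n → ℂ)) (X₂ : Set (Fin m → ℂ))
    (hX₁ : IsOpen X₁) (hX₂ : IsOpen X₂)
    (φ₁ : (Fin n → ℂ) → ℝ) (φ₂ : (Fin m → ℂ) → ℝ)
    (hw₁ : IsWeight X₁ φ₁) (hw₂ : IsWeight X₂ φ₂)
    (he₁ : EvalBound X₁ φ₁) (he₂ : EvalBound X₂ φ₂)
    (g : T → (Fin m → ℂ) → ℂ)
    (hgmem : ∀ τ, MemA2 X₂ φ₂ (g τ))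
    (hgon : ∀ τ σ, innerA2 X₂ φ₂ (g τ) (g σ) = if τ = σ then 1 else 0)
    (hgcomp : ∀ h : (Fin m → ℂ) → ℂ, MemA2 X₂ φ₂ h →
      (∀ τ, innerA2 X₂ φ₂ h (g τ) = 0) → ∀ w ∈ X₂, h w = 0)
    (f : (Fin n → ℂ) × (Fin m → ℂ) → ℂ)
    (hf : MemA2 (X₁ ×ˢ X₂) (prodWeight φ₁ φ₂) f) :
    (∀ τ : T, MemA2 X₁ φ₁
      (fun z => ∫ u in X₂, f (z, u) * (starRingEnd ℂ) (g τ u) * (φ₂ u : ℂ))) ∧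
    Filter.Tendsto (fun s : Finset T =>
        normSqA2 (X₁ ×ˢ X₂) (prodWeight φ₁ φ₂)
          (fun p => f p - ∑ τ ∈ s,
            (∫ u in X₂, f (p.1, u) * (starRingEnd ℂ) (g τ u) * (φ₂ u : ℂ)) * g τ p.2))
      Filter.atTop (nhds 0) ∧
    HasSum (fun τ : T => normSqA2 X₁ φ₁
        (fun z => ∫ u in X₂, f (z, u) * (starRingEnd ℂ) (g τ u) * (φ₂ u : ℂ)))
      (normSqA2 (X₁ ×ˢ X₂) (prodWeight φ₁ φ₂) f) := by
  obtain ⟨hw, hν⟩ := prodWeight_isWeight hw₁ hw₂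
  have hXo : IsOpen (X₁ ×ˢ X₂) := hX₁.prod hX₂
  have hfi : Integrable (fun p => ‖f p‖ ^ 2) ((nuW X₁ φ₁).prod (nuW X₂ φ₂)) := by
    rw [← hν]; exact ((nuW_mem hw f).1 hf).2
  have hfL : MemLp f 2 ((nuW X₁ φ₁).prod (nuW X₂ φ₂)) := by
    rw [← hν]; exact nuW_memLp hXo hw hf
  have hd2 : ∀ z ∈ X₁, DifferentiableOn ℂ (fun u => f (z, u)) X₂ := fun z hz =>
    hf.1.comp (by fun_prop) (fun u hu => ⟨hz, hu⟩)
  have hd1 : ∀ u ∈ X₂, DifferentiableOn ℂ (fun z => f (z, u)) X₁ := fun u hu =>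
    hf.1.comp (by fun_prop) (fun z hz => ⟨hz, hu⟩)
  set M : (Fin m → ℂ) → ℝ := fun u => ∫ z, ‖f (z, u)‖ ^ 2 ∂(nuW X₁ φ₁) with hM
  have hMi : Integrable M (nuW X₂ φ₂) := hfi.integral_prod_right
  have hMb : ∀ K : Set (Fin n → ℂ), K ⊆ X₁ → IsCompact K → ∃ C : ℝ,
      ∀ᵐ u ∂(nuW X₂ φ₂), ∀ z ∈ K, ‖f (z, u)‖ ^ 2 ≤ C * M u := by
    intro K hK hKc
    obtain ⟨C, hC⟩ := he₁ K hK hKc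
    refine ⟨C, ?_⟩
    filter_upwards [hfi.prod_left_ae, nuW_ae_mem hX₂] with u h1 h2 z hz
    have := hC (fun z => f (z, u)) ((nuW_mem hw₁ _).2 ⟨hd1 u h2, h1⟩) z hz
    rwa [nuW_normSq hw₁] at this
  have hsl : ∀ z ∈ X₁, MemA2 X₂ φ₂ (fun u => f (z, u)) := by
    intro z hz
    obtain ⟨C, hC⟩ := hMb {z} (by simpa using hz) isCompact_singleton
    refine (nuW_mem hw₂ _).2 ⟨hd2 z hz, ?_⟩
    refine (hMi.const_mul C).mono' ((nuW_meas hX₂ (hd2 z hz).continuousOn).norm.pow 2) ?_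
    filter_upwards [hC] with u hu
    have := hu z (Set.mem_singleton z)
    rwa [Real.norm_of_nonneg (by positivity)]
  set c : T → (Fin n → ℂ) → ℂ :=
    fun τ z => ∫ u in X₂, f (z, u) * (starRingEnd ℂ) (g τ u) * (φ₂ u : ℂ) with hcdef
  have hci : ∀ τ z, c τ z = innerA2 X₂ φ₂ (fun u => f (z, u)) (g τ) := fun τ z => rfl
  have hcd : ∀ τ, DifferentiableOn ℂ (c τ) X₁ := by
    intro τ
    have e : c τ = fun z => ∫ u, f (z, u) * (starRingEnd ℂ) (g τ u) ∂(nuW X₂ φ₂) := by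
      funext z
      rw [hci, nuW_inner hw₂]
    rw [e]
    apply aux_holo_integral hX₁
    · filter_upwards [nuW_ae_mem hX₂] with u hu
      exact (hd1 u hu).mul_const _
    · intro z hz
      exact (nuW_meas hX₂ (hd2 z hz).continuousOn).mul
        (Complex.continuous_conj.comp_aestronglyMeasurable
          (nuW_meas hX₂ (hgmem τ).1.continuousOn))
    · intro K hK hKc
      obtain ⟨C, hC⟩ := hMb K hK hKc
      have hg2 : Integrable (fun u => ‖g τ u‖ ^ 2) (nuW X₂ φ₂) :=
        ((nuW_mem hw₂ _).1 (hgmem τ)).2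
      have hMC : Integrable (fun u => C * M u) (nuW X₂ φ₂) := hMi.const_mul C
      have hsum : Integrable (fun u => C * M u + ‖g τ u‖ ^ 2) (nuW X₂ φ₂) := hMC.add hg2
      have hb : Integrable (fun u => (C * M u + ‖g τ u‖ ^ 2) / 2) (nuW X₂ φ₂) :=
        hsum.div_const 2
      refine ⟨_, hb, ?_⟩
      filter_upwards [hC] with u hu z hz
      have := hu z hz
      rw [norm_mul, RCLike.norm_conj]
      nlinarith [sq_nonneg (‖f (z, u)‖ - ‖g τ u‖)]
  have hP := fun z (hz : z ∈ X₁) =>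
    aux_expansion hX₂ hw₂ he₂ g hgmem hgon hgcomp (fun u => f (z, u)) (hsl z hz)
  simp only [← hci] at hP
  have hNi : Integrable (fun z => normSqA2 X₂ φ₂ (fun u => f (z, u))) (nuW X₁ φ₁) := by
    simp only [nuW_normSq hw₂]
    exact hfi.integral_prod_left
  have hcm : ∀ τ, AEStronglyMeasurable (c τ) (nuW X₁ φ₁) := fun τ =>
    nuW_meas hX₁ (hcd τ).continuousOn
  have hcInt : ∀ τ, Integrable (fun z => ‖c τ z‖ ^ 2) (nuW X₁ φ₁) := by
    intro τ
    refine hNi.mono' ((hcm τ).norm.pow 2) ?_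
    filter_upwards [nuW_ae_mem hX₁] with z hz
    rw [Real.norm_of_nonneg (by positivity)]
    exact le_hasSum (hP z hz).1 τ fun _ _ => by positivity
  have hnf : normSqA2 (X₁ ×ˢ X₂) (prodWeight φ₁ φ₂) f =
      ∫ z, normSqA2 X₂ φ₂ (fun u => f (z, u)) ∂(nuW X₁ φ₁) := by
    rw [nuW_normSq hw, hν, integral_prod _ hfi]
    simp only [nuW_normSq hw₂]
  have hPars : HasSum (fun τ : T => normSqA2 X₁ φ₁ (c τ))
      (normSqA2 (X₁ ×ˢ X₂) (prodWeight φ₁ φ₂) f) := by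
    rw [hnf]
    simp only [nuW_normSq hw₁]
    refine hasSum_integral_of_dominated_convergence (fun τ z => ‖c τ z‖ ^ 2)
      (fun τ => (hcInt τ).1) ?_ ?_ ?_ ?_
    · intro τ
      exact Filter.Eventually.of_forall fun z => by rw [Real.norm_of_nonneg (by positivity)]
    · filter_upwards [nuW_ae_mem hX₁] with z hz
      exact (hP z hz).1.summable
    · refine hNi.congr ?_
      filter_upwards [nuW_ae_mem hX₁] with z hz
      exact (hP z hz).1.tsum_eq.symm
    · filter_upwards [nuW_ae_mem hX₁] with z hz
      exact (hP z hz).1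
  refine ⟨fun τ => (nuW_mem hw₁ _).2 ⟨hcd τ, hcInt τ⟩, ?_, hPars⟩
  have hkey : ∀ s : Finset T, normSqA2 (X₁ ×ˢ X₂) (prodWeight φ₁ φ₂)
      (fun p => f p - ∑ τ ∈ s, c τ p.1 * g τ p.2) =
      normSqA2 (X₁ ×ˢ X₂) (prodWeight φ₁ φ₂) f - ∑ τ ∈ s, normSqA2 X₁ φ₁ (c τ) := by
    intro s
    have hterm : ∀ τ, MemLp (fun p : (Fin n → ℂ) × (Fin m → ℂ) => c τ p.1 * g τ p.2) 2
        ((nuW X₁ φ₁).prod (nuW X₂ φ₂)) := by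
      intro τ
      have hmm : AEStronglyMeasurable
          (fun p : (Fin n → ℂ) × (Fin m → ℂ) => c τ p.1 * g τ p.2)
          ((nuW X₁ φ₁).prod (nuW X₂ φ₂)) :=
        (hcm τ).comp_fst.mul (nuW_meas hX₂ (hgmem τ).1.continuousOn).comp_snd
      refine (memLp_two_iff_integrable_sq_norm hmm).2 ?_
      simp only [norm_mul, mul_pow]
      exact (hcInt τ).mul_prod ((nuW_mem hw₂ _).1 (hgmem τ)).2
    have hE : MemLp (fun p => f p - ∑ τ ∈ s, c τ p.1 * g τ p.2) 2
        ((nuW X₁ φ₁).prod (nuW X₂ φ₂)) :=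
      hfL.sub (memLp_finsetSum s fun τ _ => hterm τ)
    rw [nuW_normSq hw, hν, integral_prod _ ((memLp_two_iff_integrable_sq_norm hE.1).1 hE), hnf]
    simp only [nuW_normSq hw₁]
    rw [← integral_finsetSum s (fun τ _ => hcInt τ),
      ← integral_sub hNi (integrable_finsetSum s fun τ _ => hcInt τ)]
    refine integral_congr_ae ?_
    filter_upwards [nuW_ae_mem hX₁] with z hz
    have := (hP z hz).2 s
    rw [nuW_normSq hw₂] at this
    exact this
  have hlim : Filter.Tendsto (fun s : Finset T =>
      normSqA2 (X₁ ×ˢ X₂) (prodWeight φ₁ φ₂) f - ∑ τ ∈ s, normSqA2 X₁ φ₁ (c τ))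
      Filter.atTop (nhds 0) := by
    have := Filter.Tendsto.const_sub (normSqA2 (X₁ ×ˢ X₂) (prodWeight φ₁ φ₂) f) hPars
    simpa using this
  refine hlim.congr fun s => ?_
  exact (hkey s).symm
end
end

section
/- Let U ⊆ ℂ^m be a domain, u₀ ∈ U, and let γ be a weight on U satisfying the evaluation bound. Then there exist a subset S₂ ⊆ ℕ^m and a family (f_α)_{α∈S₂} in A²(U,γ) such that: (i) the family is orthonormal, i.e. ⟨f_α,f_β⟩_{U,γ} = 1 if α = β and 0 otherwise; (ii) the family is complete, i.e. every g ∈ A²(U,γ) with ⟨g,f_α⟩_{U,γ} = 0 for all α ∈ S₂ is identically zero; (iii) ord_{u₀}(f_α) = α for every α ∈ S₂, i.e. ∂^α f_α(u₀) ≠ 0 and ∂^β f_α(u₀) = 0 for every β < α. -/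
open MeasureTheory

noncomputable section

/-- The partial derivative `∂f/∂z_j` (as a function), for `f : ℂᵏ → ℂ`. -/
def partialDerivAt {k : ℕ} (j : Fin k) (f : (Fin k → ℂ) → ℂ) : (Fin k → ℂ) → ℂ :=
  fun z => fderiv ℂ f z (Pi.single j 1)

/-- The iterated partial derivative `∂^β f` of multi-order `β`. -/
def multiDeriv {k : ℕ} (β : Fin k → ℕ) (f : (Fin k → ℂ) → ℂ) : (Fin k → ℂ) → ℂ :=
  (List.finRange k).foldr (fun j g => (partialDerivAt j)^[β j] g) f

/-- The order `a < b` on multi-indices: `|a| < |b|`, or `|a| = |b|` and `a` is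
lexicographically smaller than `b`. -/
def MIdxLT {k : ℕ} (a b : Fin k → ℕ) : Prop :=
  (∑ i, a i) < (∑ i, b i) ∨
    ((∑ i, a i) = (∑ i, b i) ∧ ∃ j : Fin k, (∀ l, l < j → a l = b l) ∧ a j < b j)

section ComplexAnalysis

open Metric Filter Topology Set

variable {m : ℕ} {U : Set (Fin m → ℂ)}

/-- Cauchy estimate for the Fréchet derivative. -/
theorem aux_fderiv_bound {f : (Fin m → ℂ) → ℂ} (hU : IsOpen U) (hf : DifferentiableOn ℂ f U)
    {z : Fin m → ℂ} {r M : ℝ} (hr : 0 < r) (hz : closedBall z r ⊆ U)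
    (hM : ∀ w ∈ closedBall z r, ‖f w‖ ≤ M) : ‖fderiv ℂ f z‖ ≤ M / r := by
  have hM0 : 0 ≤ M := (norm_nonneg _).trans (hM z (mem_closedBall_self hr.le))
  refine ContinuousLinearMap.opNorm_le_bound _ (by positivity) fun v => ?_
  rcases eq_or_ne v 0 with rfl | hv
  · simp
  have hv' : 0 < ‖v‖ := norm_pos_iff.mpr hv
  have hmem : ∀ t ∈ closedBall (0 : ℂ) (r / ‖v‖), z + t • v ∈ closedBall z r := by
    intro t ht
    simp only [mem_closedBall, dist_zero_right, dist_self_add_left] at ht ⊢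
    rw [norm_smul]
    exact (le_div_iff₀ hv').mp ht
  have hd : ∀ t ∈ closedBall (0 : ℂ) (r / ‖v‖),
      HasDerivAt (fun t : ℂ => f (z + t • v)) (fderiv ℂ f (z + t • v) v) t := by
    intro t ht
    have h1 : HasFDerivAt f (fderiv ℂ f (z + t • v)) (z + t • v) :=
      (hf.differentiableAt (hU.mem_nhds (hz (hmem t ht)))).hasFDerivAt
    have h2 : HasDerivAt (fun t : ℂ => z + t • v) v t := by
      simpa using ((hasDerivAt_id t).smul_const v).const_add z
    exact h1.comp_hasDerivAt t h2
  have h0 : (0 : ℂ) ∈ closedBall (0 : ℂ) (r / ‖v‖) := mem_closedBall_self (by positivity)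
  have key := Complex.norm_deriv_le_of_forall_mem_sphere_norm_le (c := 0) (R := r / ‖v‖) (C := M)
    (f := fun t : ℂ => f (z + t • v)) (by positivity) ?_ ?_
  · rw [(hd 0 h0).deriv] at key
    simp only [zero_smul, add_zero] at key
    refine key.trans (le_of_eq ?_)
    field_simp
  · apply DifferentiableOn.diffContOnCl
    rw [closure_ball _ (by positivity)]
    exact fun t ht => (hd t ht).differentiableAt.differentiableWithinAt
  · intro t ht
    exact hM _ (hmem t (sphere_subset_closedBall ht))

theorem aux_exists_closedBall (hU : IsOpen U) {z : Fin m → ℂ} (hz : z ∈ U) :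
    ∃ r > 0, closedBall z (2 * r) ⊆ U := by
  obtain ⟨ε, hε, h⟩ := Metric.isOpen_iff.mp hU z hz
  exact ⟨ε / 4, by positivity, (closedBall_subset_ball (by linarith)).trans h⟩

/-- Locally uniform limits of holomorphic functions are holomorphic. -/
theorem aux_limit {F : ℕ → (Fin m → ℂ) → ℂ} {f : (Fin m → ℂ) → ℂ} (hU : IsOpen U)
    (hF : ∀ n, DifferentiableOn ℂ (F n) U)
    (h : ∀ K ⊆ U, IsCompact K → TendstoUniformlyOn F f atTop K) : DifferentiableOn ℂ f U := by
  intro z hz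
  obtain ⟨r, hr, hrU⟩ := aux_exists_closedBall hU hz
  have hcau : UniformCauchySeqOn (fun n => fderiv ℂ (F n)) atTop (ball z r) := by
    rw [Metric.uniformCauchySeqOn_iff]
    intro ε hε
    have hc := (h _ hrU (isCompact_closedBall _ _)).uniformCauchySeqOn
    rw [Metric.uniformCauchySeqOn_iff] at hc
    obtain ⟨N, hN⟩ := hc (ε * r / 2) (by positivity)
    refine ⟨N, fun n hn k hk x hx => ?_⟩
    have hsub : closedBall x r ⊆ closedBall z (2 * r) :=
      closedBall_subset_closedBall' (by have := mem_ball.mp hx; linarith)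
    have hxU : x ∈ U := hrU (hsub (mem_closedBall_self hr.le))
    have := aux_fderiv_bound (f := F n - F k) (M := ε * r / 2) hU ((hF n).sub (hF k)) hr
      (hsub.trans hrU) (fun w hw => by
        have := hN n hn k hk w (hsub hw)
        rw [dist_eq_norm] at this
        exact this.le)
    rw [fderiv_sub ((hF n).differentiableAt (hU.mem_nhds hxU))
      ((hF k).differentiableAt (hU.mem_nhds hxU))] at this
    rw [dist_eq_norm]
    refine this.trans_lt ?_
    rw [mul_div_assoc, mul_div_right_comm, ]
    field_simp
    norm_num
  have hlim : ∀ x ∈ ball z r, ∃ L, Tendsto (fun n => fderiv ℂ (F n) x) atTop (𝓝 L) := fun x hx =>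
    cauchySeq_tendsto_of_complete (hcau.cauchySeq hx)
  choose! g hg using hlim
  have := hasFDerivAt_of_tendstoUniformlyOn (x := z) (g := f) isOpen_ball
    (hcau.tendstoUniformlyOn_of_tendsto hg)
    (fun n x hx => ((hF n).differentiableAt (hU.mem_nhds (hrU (closedBall_subset_closedBall
      (by linarith) (ball_subset_closedBall hx))))).hasFDerivAt)
    (fun x hx => (h _ hrU (isCompact_closedBall _ _)).tendsto_at (closedBall_subset_closedBall
      (by linarith) (ball_subset_closedBall hx))) (mem_ball_self hr)
  exact this.differentiableAt.differentiableWithinAt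

/-- Directional derivatives of holomorphic functions are holomorphic. -/
theorem aux_dir_deriv {f : (Fin m → ℂ) → ℂ} (hU : IsOpen U) (hf : DifferentiableOn ℂ f U)
    (v : Fin m → ℂ) : DifferentiableOn ℂ (fun z => fderiv ℂ f z v) U := by
  intro z hz
  obtain ⟨r, hr, hrU⟩ := aux_exists_closedBall hU hz
  obtain ⟨M, hM⟩ := (isCompact_closedBall z (2 * r)).exists_bound_of_continuousOn
    (hf.continuousOn.mono hrU)
  set R : ℝ := (r / 2) / (‖v‖ + 1) with hR
  have hRpos : 0 < R := by positivity
  have hRv : R * ‖v‖ ≤ r / 2 := by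
    rw [hR, div_mul_eq_mul_div, div_le_iff₀ (by positivity)]
    nlinarith [norm_nonneg v]
  have hmem : ∀ x ∈ ball z (r / 2), ∀ t ∈ closedBall (0 : ℂ) R,
      x + t • v ∈ closedBall z r := by
    intro x hx t ht
    rw [mem_closedBall, dist_eq_norm]
    rw [mem_ball, dist_eq_norm] at hx
    rw [mem_closedBall, dist_zero_right] at ht
    calc ‖x + t • v - z‖ = ‖(x - z) + t • v‖ := by congr 1; abel
      _ ≤ ‖x - z‖ + ‖t • v‖ := norm_add_le _ _
      _ ≤ r / 2 + R * ‖v‖ := by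
        rw [norm_smul]; gcongr
      _ ≤ r := by linarith
  have hsub : closedBall z r ⊆ U := (closedBall_subset_closedBall (by linarith)).trans hrU
  have hdf : ∀ y ∈ closedBall z r, HasFDerivAt f (fderiv ℂ f y) y := fun y hy =>
    (hf.differentiableAt (hU.mem_nhds (hsub hy))).hasFDerivAt
  have hbd : ∀ y ∈ closedBall z r, ‖fderiv ℂ f y‖ ≤ M / r := by
    intro y hy
    have hs : closedBall y r ⊆ closedBall z (2 * r) :=
      closedBall_subset_closedBall' (by have := mem_closedBall.mp hy; linarith)
    exact aux_fderiv_bound hU hf hr (hs.trans hrU) fun w hw => hM w (hs hw)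
  have hcm : ∀ θ : ℝ, circleMap 0 R θ ∈ closedBall (0 : ℂ) R := fun θ =>
    circleMap_mem_closedBall _ hRpos.le _
  -- the Cauchy integral
  have hcauchy : ∀ x ∈ ball z (r / 2), fderiv ℂ f x v =
      (2 * Real.pi * Complex.I : ℂ)⁻¹ • ∫ θ in (0 : ℝ)..(2 * Real.pi),
        deriv (circleMap 0 R) θ * (circleMap 0 R θ ^ (-2 : ℤ) * f (x + circleMap 0 R θ • v)) := by
    intro x hx
    have hd : ∀ t ∈ closedBall (0 : ℂ) R,
        HasDerivAt (fun t : ℂ => f (x + t • v)) (fderiv ℂ f (x + t • v) v) t := by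
      intro t ht
      have h2 : HasDerivAt (fun t : ℂ => x + t • v) v t := by
        simpa using ((hasDerivAt_id t).smul_const v).const_add x
      exact (hdf _ (hmem x hx t ht)).comp_hasDerivAt t h2
    have h0 := DiffContOnCl.deriv_eq_smul_circleIntegral (f := fun t : ℂ => f (x + t • v)) (c := 0)
      hRpos (by
        apply DifferentiableOn.diffContOnCl
        rw [closure_ball _ hRpos.ne']
        exact fun t ht => (hd t ht).differentiableAt.differentiableWithinAt)
    rw [(hd 0 (mem_closedBall_self hRpos.le)).deriv] at h0
    have h2 : (2 * Real.pi * Complex.I : ℂ) ≠ 0 := Complex.two_pi_I_ne_zero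
    rw [eq_inv_smul_iff₀ h2]
    simpa [circleIntegral] using h0.symm
  have hcont : ∀ x ∈ ball z (r / 2), Continuous (fun θ : ℝ =>
      deriv (circleMap 0 R) θ * (circleMap 0 R θ ^ (-2 : ℤ) * f (x + circleMap 0 R θ • v))) := by
    intro x hx
    have h1 : Continuous (fun θ : ℝ => f (x + circleMap 0 R θ • v)) := by
      rw [← continuousOn_univ]
      refine (hf.continuousOn.mono hsub).comp (t := closedBall z r) ?_ ?_
      · exact (by fun_prop : Continuous fun θ : ℝ => x + circleMap 0 R θ • v).continuousOn
      · exact fun θ _ => hmem x hx _ (hcm θ)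
    have h2 : Continuous (fun θ : ℝ => circleMap 0 R θ ^ (-2 : ℤ)) :=
      (by fun_prop : Continuous (circleMap 0 R)).zpow₀ _ fun θ => Or.inl (circleMap_ne_center hRpos.ne')
    have h3 : Continuous (fun θ : ℝ => deriv (circleMap 0 R) θ) := by
      simp only [deriv_circleMap]; fun_prop
    exact h3.mul (h2.mul h1)
  have hcont' : Continuous (fun θ : ℝ => deriv (circleMap 0 R) θ * circleMap 0 R θ ^ (-2 : ℤ)) := by
    have h2 : Continuous (fun θ : ℝ => circleMap 0 R θ ^ (-2 : ℤ)) :=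
      (by fun_prop : Continuous (circleMap 0 R)).zpow₀ _ fun θ => Or.inl (circleMap_ne_center hRpos.ne')
    have h3 : Continuous (fun θ : ℝ => deriv (circleMap 0 R) θ) := by
      simp only [deriv_circleMap]; fun_prop
    exact h3.mul h2
  have hz0 : z ∈ ball z (r / 2) := mem_ball_self (by positivity)
  have key := intervalIntegral.hasFDerivAt_integral_of_dominated_of_fderiv_le (𝕜 := ℂ)
    (μ := volume) (a := 0) (b := 2 * Real.pi) (x₀ := z) (s := ball z (r / 2))
    (F := fun x θ =>
      deriv (circleMap 0 R) θ * (circleMap 0 R θ ^ (-2 : ℤ) * f (x + circleMap 0 R θ • v)))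
    (F' := fun x θ => (deriv (circleMap 0 R) θ * circleMap 0 R θ ^ (-2 : ℤ)) •
      fderiv ℂ f (x + circleMap 0 R θ • v))
    (bound := fun θ => ‖deriv (circleMap 0 R) θ * circleMap 0 R θ ^ (-2 : ℤ)‖ * (M / r))
    (isOpen_ball.mem_nhds hz0)
    (by
      filter_upwards [isOpen_ball.mem_nhds hz0] with x hx
      exact (hcont x hx).aestronglyMeasurable)
    ((hcont z hz0).intervalIntegrable _ _)
    (by
      refine (hcont'.stronglyMeasurable.smul ?_).aestronglyMeasurable
      exact ((measurable_fderiv ℂ f).comp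
        (by fun_prop : Continuous fun θ : ℝ => z + circleMap 0 R θ • v).measurable).stronglyMeasurable)
    (by
      refine Eventually.of_forall fun θ _ x hx => ?_
      rw [norm_smul]
      gcongr
      exact hbd _ (hmem x hx _ (hcm θ)))
    ((hcont'.norm.mul continuous_const).intervalIntegrable _ _)
    (by
      refine Eventually.of_forall fun θ _ x hx => ?_
      have h1 : HasFDerivAt (fun x => f (x + circleMap 0 R θ • v))
          (fderiv ℂ f (x + circleMap 0 R θ • v)) x :=
        (hasFDerivAt_comp_add_right _).mpr (hdf _ (hmem x hx _ (hcm θ)))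
      have h2 := h1.const_mul (deriv (circleMap 0 R) θ * circleMap 0 R θ ^ (-2 : ℤ))
      simpa only [mul_assoc] using h2)
  have h3 := key.differentiableAt.const_smul ((2 * Real.pi * Complex.I : ℂ)⁻¹)
  refine DifferentiableAt.differentiableWithinAt ?_
  refine h3.congr_of_eventuallyEq ?_
  filter_upwards [isOpen_ball.mem_nhds hz0] with x hx
  exact hcauchy x hx

end ComplexAnalysis

section HolOps

open Metric Filter Topology Set

variable {m : ℕ} {U : Set (Fin m → ℂ)}

/-- Holomorphic functions on `U`, normalised to vanish off `U`. -/
def holSub (U : Set (Fin m → ℂ)) : Submodule ℂ ((Fin m → ℂ) → ℂ) where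
  carrier := {f | DifferentiableOn ℂ f U ∧ ∀ x, x ∉ U → f x = 0}
  add_mem' := by
    rintro f g ⟨hf, hf'⟩ ⟨hg, hg'⟩
    exact ⟨hf.add hg, fun x hx => by simp [hf' x hx, hg' x hx]⟩
  zero_mem' := ⟨differentiableOn_const 0, fun _ _ => rfl⟩
  smul_mem' := by
    rintro c f ⟨hf, hf'⟩
    exact ⟨hf.const_smul c, fun x hx => by simp [hf' x hx]⟩

theorem holSub_diff (f : holSub U) : DifferentiableOn ℂ (f : (Fin m → ℂ) → ℂ) U := f.2.1

theorem holSub_diffAt (hU : IsOpen U) (f : holSub U) {z : Fin m → ℂ} (hz : z ∈ U) :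
    DifferentiableAt ℂ (f : (Fin m → ℂ) → ℂ) z := f.2.1.differentiableAt (hU.mem_nhds hz)

theorem holSub_ext {f g : holSub U} (h : ∀ z ∈ U, (f : (Fin m → ℂ) → ℂ) z = g.1 z) : f = g := by
  ext z
  by_cases hz : z ∈ U
  · exact h z hz
  · rw [f.2.2 z hz, g.2.2 z hz]

/-- The holomorphic function on `U` given by restricting `f`. -/
def holMk (f : (Fin m → ℂ) → ℂ) (hf : DifferentiableOn ℂ f U) : holSub U :=
  ⟨U.indicator f, hf.congr fun _ hx => indicator_of_mem hx f, fun _ hx => indicator_of_notMem hx f⟩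

theorem holMk_apply (f : (Fin m → ℂ) → ℂ) (hf : DifferentiableOn ℂ f U) {z : Fin m → ℂ}
    (hz : z ∈ U) : (holMk f hf).1 z = f z := indicator_of_mem hz f

/-- Directional derivative as an operator. -/
def dirOp (hU : IsOpen U) (v : Fin m → ℂ) : Module.End ℂ (holSub U) where
  toFun f := holMk (fun z => fderiv ℂ f.1 z v) (aux_dir_deriv hU f.2.1 v)
  map_add' f g := by
    apply holSub_ext
    intro z hz
    rw [holMk_apply _ _ hz, Submodule.coe_add, Submodule.coe_add,
      fderiv_add (holSub_diffAt hU f hz) (holSub_diffAt hU g hz), Pi.add_apply,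
      holMk_apply _ _ hz, holMk_apply _ _ hz]
    rfl
  map_smul' c f := by
    apply holSub_ext
    intro z hz
    rw [holMk_apply _ _ hz, Submodule.coe_smul,
      fderiv_const_smul (holSub_diffAt hU f hz), RingHom.id_apply, Submodule.coe_smul,
      Pi.smul_apply, holMk_apply _ _ hz]
    rfl

theorem dirOp_apply (hU : IsOpen U) (v : Fin m → ℂ) (f : holSub U) {z : Fin m → ℂ} (hz : z ∈ U) :
    (dirOp hU v f).1 z = fderiv ℂ f.1 z v :=
  holMk_apply _ (aux_dir_deriv hU f.2.1 v) hz

theorem aux_fderiv_sum (L : (Fin m → ℂ) →L[ℂ] ℂ) (v : Fin m → ℂ) :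
    L v = ∑ j, v j * L (Pi.single j 1) := by
  conv_lhs => rw [← Finset.univ_sum_single v]
  rw [map_sum]
  refine Finset.sum_congr rfl fun j _ => ?_
  have : (Pi.single j (v j) : Fin m → ℂ) = v j • Pi.single j 1 := by
    rw [← Pi.single_smul]; simp
  rw [this, map_smul, smul_eq_mul]

theorem aux_fderiv_diff (hU : IsOpen U) {f : (Fin m → ℂ) → ℂ} (hf : DifferentiableOn ℂ f U) :
    DifferentiableOn ℂ (fderiv ℂ f) U := by
  have : fderiv ℂ f = fun z => ∑ j, (fderiv ℂ f z (Pi.single j 1)) •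
      (ContinuousLinearMap.proj j : (Fin m → ℂ) →L[ℂ] ℂ) := by
    ext z v
    rw [aux_fderiv_sum]
    simp [mul_comm]
  rw [this]
  exact DifferentiableOn.fun_sum fun j _ => (aux_dir_deriv hU hf _).smul_const _

theorem dirOp_comm (hU : IsOpen U) (v w : Fin m → ℂ) : Commute (dirOp hU v) (dirOp hU w) := by
  have key : ∀ (v w : Fin m → ℂ) (f : holSub U), ∀ z ∈ U, (dirOp hU v (dirOp hU w f)).1 z =
      fderiv ℂ (fderiv ℂ f.1) z v w := by
    intro v w f z hz
    rw [dirOp_apply hU _ _ hz]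
    have h1 : (dirOp hU w f).1 =ᶠ[𝓝 z] fun z => fderiv ℂ f.1 z w := by
      filter_upwards [hU.mem_nhds hz] with y hy
      exact dirOp_apply hU w f hy
    rw [h1.fderiv_eq, fderiv_clm_apply ((aux_fderiv_diff hU f.2.1).differentiableAt
      (hU.mem_nhds hz)) (differentiableAt_const w)]
    simp
  apply LinearMap.ext
  intro f
  apply holSub_ext
  intro z hz
  rw [Module.End.mul_apply, Module.End.mul_apply, key _ _ _ z hz, key _ _ _ z hz]
  apply second_derivative_symmetric_of_eventually (f := f.1) (f' := fderiv ℂ f.1) (x := z)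
  · filter_upwards [hU.mem_nhds hz] with y hy
    exact (holSub_diffAt hU f hy).hasFDerivAt
  · exact ((aux_fderiv_diff hU f.2.1).differentiableAt (hU.mem_nhds hz)).hasFDerivAt

/-- The operator `∂^β`. -/
def mOp (hU : IsOpen U) (β : Fin m → ℕ) : Module.End ℂ (holSub U) :=
  ((List.finRange m).map (fun j => dirOp hU (Pi.single j 1) ^ β j)).prod

theorem aux_iterate (hU : IsOpen U) (j : Fin m) (n : ℕ) (g : (Fin m → ℂ) → ℂ) (h : holSub U)
    (hgh : EqOn g h.1 U) :
    EqOn ((partialDerivAt j)^[n] g) ((dirOp hU (Pi.single j 1) ^ n) h).1 U := by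
  induction n with
  | zero => simpa using hgh
  | succ n ih =>
    intro z hz
    rw [Function.iterate_succ_apply', pow_succ', Module.End.mul_apply, dirOp_apply hU _ _ hz,
      partialDerivAt, (ih.eventuallyEq_of_mem (hU.mem_nhds hz)).fderiv_eq]

theorem mOp_apply (hU : IsOpen U) (β : Fin m → ℕ) (f : (Fin m → ℂ) → ℂ) (h : holSub U)
    (hfh : EqOn f h.1 U) : EqOn (multiDeriv β f) (mOp hU β h).1 U := by
  unfold multiDeriv mOp
  generalize List.finRange m = l
  induction l with
  | nil => simpa using hfh
  | cons j l ih =>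
    rw [List.foldr_cons, List.map_cons, List.prod_cons, Module.End.mul_apply]
    exact aux_iterate hU j _ _ _ ih

theorem mOp_succ (hU : IsOpen U) (β : Fin m → ℕ) (i : Fin m) :
    mOp hU (β + Pi.single i 1) = mOp hU β * dirOp hU (Pi.single i 1) := by
  have key : ∀ l : List (Fin m), l.Nodup →
      (l.map (fun j => dirOp hU (Pi.single j 1) ^ (β + Pi.single i 1 : Fin m → ℕ) j)).prod =
      (l.map (fun j => dirOp hU (Pi.single j 1) ^ β j)).prod *
        (if i ∈ l then dirOp hU (Pi.single i 1) else 1) := by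
    intro l hl
    induction l with
    | nil => simp
    | cons j l ih =>
      rw [List.nodup_cons] at hl
      rw [List.map_cons, List.prod_cons, List.map_cons, List.prod_cons, ih hl.2]
      by_cases hij : i = j
      · subst hij
        have hc : Commute (dirOp hU (Pi.single i 1))
            ((l.map (fun j => dirOp hU (Pi.single j 1) ^ β j)).prod) := by
          apply Commute.list_prod_right
          intro x hx
          obtain ⟨k, _, rfl⟩ := List.mem_map.mp hx
          exact (dirOp_comm hU _ _).pow_right _
        simp only [hl.1, if_false, mul_one, List.mem_cons, true_or, if_true, Pi.add_apply,
          Pi.single_eq_same, pow_succ]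
        rw [mul_assoc, mul_assoc, hc.eq]
      · simp only [List.mem_cons, hij, false_or, Pi.add_apply]
        rw [Pi.single_eq_of_ne (Ne.symm hij), add_zero, mul_assoc]
  have := key (List.finRange m) (List.nodup_finRange m)
  simpa [mOp] using this

theorem mOp_zero (hU : IsOpen U) : mOp hU 0 = 1 := by
  simp [mOp]

/-- all derivatives vanish -/
def allZero (hU : IsOpen U) (z : Fin m → ℂ) (f : holSub U) : Prop :=
  ∀ β, (mOp hU β f).1 z = 0

theorem allZero_dirOp (hU : IsOpen U) {z : Fin m → ℂ} {f : holSub U} (h : allZero hU z f)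
    (v : Fin m → ℂ) : allZero hU z (dirOp hU v f) := by
  have h1 : dirOp hU v f = ∑ j, v j • dirOp hU (Pi.single j 1) f := by
    apply holSub_ext
    intro z hz
    rw [dirOp_apply hU _ _ hz, aux_fderiv_sum]
    rw [AddSubmonoidClass.coe_finsetSum, Finset.sum_apply]
    refine Finset.sum_congr rfl fun j _ => ?_
    rw [Submodule.coe_smul, Pi.smul_apply, dirOp_apply hU _ _ hz, smul_eq_mul]
  intro β
  rw [h1, map_sum, AddSubmonoidClass.coe_finsetSum, Finset.sum_apply]
  refine Finset.sum_eq_zero fun j _ => ?_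
  rw [map_smul, Submodule.coe_smul, Pi.smul_apply, ← Module.End.mul_apply, ← mOp_succ, h,
    smul_zero]

theorem allZero_dirOp_pow (hU : IsOpen U) {z : Fin m → ℂ} {f : holSub U} (h : allZero hU z f)
    (v : Fin m → ℂ) (n : ℕ) : allZero hU z ((dirOp hU v ^ n) f) := by
  induction n with
  | zero => simpa using h
  | succ n ih =>
    rw [pow_succ', Module.End.mul_apply]
    exact allZero_dirOp hU ih v

theorem allZero_mOp (hU : IsOpen U) {z : Fin m → ℂ} {f : holSub U} (h : allZero hU z f)
    (β : Fin m → ℕ) : allZero hU z (mOp hU β f) := by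
  unfold mOp
  generalize List.finRange m = l
  induction l with
  | nil => simpa using h
  | cons j l ih =>
    rw [List.map_cons, List.prod_cons, Module.End.mul_apply]
    exact allZero_dirOp_pow hU ih _ _

theorem allZero_ball (hU : IsOpen U) {z : Fin m → ℂ} {f : holSub U} (h : allZero hU z f)
    {r : ℝ} (hr : ball z r ⊆ U) {w : Fin m → ℂ} (hw : w ∈ ball z r) : f.1 w = 0 := by
  have hr0 : 0 < r := pos_of_mem_ball hw
  have h00 : f.1 z = 0 := by simpa [mOp_zero] using h 0
  rcases eq_or_ne w z with rfl | hwz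
  · exact h00
  set v := w - z with hv
  have hv0 : 0 < ‖v‖ := norm_pos_iff.mpr (sub_ne_zero.mpr hwz)
  have hmem : ∀ t ∈ ball (0 : ℂ) (r / ‖v‖), z + t • v ∈ U := by
    intro t ht
    apply hr
    simp only [mem_ball, dist_zero_right, dist_self_add_left] at ht ⊢
    rw [norm_smul]
    exact (lt_div_iff₀ hv0).mp ht
  have hd : ∀ g : holSub U, ∀ t ∈ ball (0 : ℂ) (r / ‖v‖),
      HasDerivAt (fun t : ℂ => g.1 (z + t • v)) ((dirOp hU v g).1 (z + t • v)) t := by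
    intro g t ht
    have h2 : HasDerivAt (fun t : ℂ => z + t • v) v t := by
      simpa using ((hasDerivAt_id t).smul_const v).const_add z
    rw [dirOp_apply hU _ _ (hmem t ht)]
    exact (holSub_diffAt hU g (hmem t ht)).hasFDerivAt.comp_hasDerivAt t h2
  have hit : ∀ n : ℕ, ∀ t ∈ ball (0 : ℂ) (r / ‖v‖),
      iteratedDeriv n (fun t : ℂ => f.1 (z + t • v)) t = ((dirOp hU v ^ n) f).1 (z + t • v) := by
    intro n
    induction n with
    | zero => intro t _; simp
    | succ n ih =>
      intro t ht
      rw [iteratedDeriv_succ, pow_succ', Module.End.mul_apply]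
      have : iteratedDeriv n (fun t : ℂ => f.1 (z + t • v)) =ᶠ[𝓝 t]
          fun t => ((dirOp hU v ^ n) f).1 (z + t • v) := by
        filter_upwards [isOpen_ball.mem_nhds ht] with s hs using ih s hs
      rw [this.deriv_eq, (hd _ t ht).deriv]
  have h1 : (1 : ℂ) ∈ ball (0 : ℂ) (r / ‖v‖) := by
    simp only [mem_ball, dist_zero_right, norm_one]
    rw [lt_div_iff₀ hv0, one_mul, hv, ← dist_eq_norm]
    exact hw
  have ht := Complex.taylorSeries_eq_on_ball (f := fun t : ℂ => f.1 (z + t • v)) (c := 0)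
    (r := (r / ‖v‖)) (fun t ht => (hd f t ht).differentiableAt.differentiableWithinAt) h1
  have h3 : ∀ n : ℕ, iteratedDeriv n (fun t : ℂ => f.1 (z + t • v)) 0 = 0 := by
    intro n
    rw [hit n 0 (mem_ball_self (by positivity))]
    have := allZero_dirOp_pow hU h v n 0
    simpa [mOp_zero] using this
  simp only [h3, smul_zero, tsum_zero] at ht
  rw [hv] at ht
  simpa using ht.symm

theorem allZero_eq_zero (hU : IsOpen U) (hc : IsPreconnected U) {z : Fin m → ℂ} (hz : z ∈ U)
    {f : holSub U} (h : allZero hU z f) : f = 0 := by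
  have hsub : U ⊆ {w | w ∈ U ∧ allZero hU w f} := by
    apply hc.subset_of_closure_inter_subset
    · rw [isOpen_iff_mem_nhds]
      rintro w ⟨hw, hwz⟩
      obtain ⟨r, hr, hrU⟩ := Metric.isOpen_iff.mp hU w hw
      filter_upwards [ball_mem_nhds w hr] with y hy
      exact ⟨hrU hy, fun β => allZero_ball hU (allZero_mOp hU hwz β) hrU hy⟩
    · exact ⟨z, hz, hz, h⟩
    · rintro w ⟨hw, hwU⟩
      refine ⟨hwU, fun β => ?_⟩
      have hcont := (holSub_diffAt hU (mOp hU β f) hwU).continuousAt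
      rw [mem_closure_iff_frequently] at hw
      by_contra hne
      have := hcont.eventually_ne hne
      obtain ⟨y, hy1, hy2⟩ := (hw.and_eventually this).exists
      exact hy2 (hy1.2 β)
  apply holSub_ext
  intro w hw
  have := (hsub hw).2 0
  simpa [mOp_zero] using this

end HolOps

section HilbertAux

open Set

theorem hilbert_aux {W : Type*} [NormedAddCommGroup W] [InnerProductSpace ℂ W] [CompleteSpace W]
    {ι : Type*} [DecidableEq ι] (r : ι → ι → Prop) (hwf : WellFounded r)
    (htri : ∀ a b, a ≠ b → r a b ∨ r b a) (htrans : ∀ a b c, r a b → r b c → r a c)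
    (L : ι → W →L[ℂ] ℂ) (hL : ∀ x, (∀ β, L β x = 0) → x = 0) :
    ∃ (S : Set ι) (f : ι → W),
      (∀ α ∈ S, ∀ β ∈ S, inner ℂ (f α) (f β) = if α = β then (1 : ℂ) else 0) ∧
      (∀ g, (∀ α ∈ S, inner ℂ (f α) g = (0 : ℂ)) → g = 0) ∧
      (∀ α ∈ S, L α (f α) ≠ 0 ∧ ∀ β, r β α → L β (f α) = 0) := by
  have hx : ∀ α, ∃ x : W, (∀ β, r β α → L β x = 0) ∧
      ∀ y : W, (∀ β, r β α → L β y = 0) → L α y = inner ℂ x y := by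
    intro α
    let V : Submodule ℂ W := ⨅ β : {β // r β α}, LinearMap.ker (L β.1 : W →ₗ[ℂ] ℂ)
    have hV : ∀ y, y ∈ V ↔ ∀ β, r β α → L β y = 0 := by
      intro y
      simp [V, Submodule.mem_iInf]
    have hVc : IsClosed (V : Set W) := by
      simp only [V, Submodule.coe_iInf]
      exact isClosed_iInter fun β => (L β.1).isClosed_ker
    have : CompleteSpace V := hVc.completeSpace_coe
    let x : V := (InnerProductSpace.toDual ℂ V).symm ((L α).comp V.subtypeL)
    refine ⟨x.1, (hV _).mp x.2, fun y hy => ?_⟩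
    have := InnerProductSpace.toDual_symm_apply (𝕜 := ℂ) (x := (⟨y, (hV y).mpr hy⟩ : V))
      (y := (L α).comp V.subtypeL)
    rw [Submodule.coe_inner] at this
    exact this.symm
  choose x hx1 hx2 using hx
  have horth : ∀ α β, r α β → inner ℂ (x α) (x β) = (0 : ℂ) := by
    intro α β hab
    rw [← hx2 α (x β) fun δ hδ => hx1 β δ (htrans _ _ _ hδ hab)]
    exact hx1 β α hab
  refine ⟨{α | x α ≠ 0}, fun α => ((‖x α‖ : ℂ)⁻¹) • x α, ?_, ?_, ?_⟩
  · intro α hα β hβ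
    rw [inner_smul_left, inner_smul_right]
    split_ifs with h
    · subst h
      have : (‖x α‖ : ℂ) ≠ 0 := by simpa using hα
      rw [inner_self_eq_norm_sq_to_K]
      simp only [map_inv₀, Complex.conj_ofReal, Complex.coe_algebraMap]
      field_simp
    · have : inner ℂ (x α) (x β) = (0 : ℂ) := by
        rcases htri α β h with h' | h'
        · exact horth _ _ h'
        · exact inner_eq_zero_symm.mp (horth _ _ h')
      rw [this]; simp
  · intro g hg
    by_contra hg0
    have hne : ∃ β, L β g ≠ 0 := by
      by_contra hh
      push Not at hh
      exact hg0 (hL g hh)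
    obtain ⟨α, hα, hmin⟩ := hwf.has_min {β | L β g ≠ 0} hne
    have h1 := hx2 α g fun β hβ => by
      by_contra hh
      exact hmin β hh hβ
    have hα' : L α g ≠ 0 := hα
    rw [h1] at hα'
    have hxα : x α ≠ 0 := by
      intro h0
      simp [h0] at hα'
    have := hg α hxα
    rw [inner_smul_left] at this
    have hn : (‖x α‖ : ℂ) ≠ 0 := by simpa using hxα
    simp [hα', hxα] at this
  · intro α hα
    have hn : (‖x α‖ : ℂ) ≠ 0 := by simpa using hα
    refine ⟨?_, fun β hβ => by rw [map_smul, hx1 α β hβ, smul_zero]⟩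
    rw [map_smul, hx2 α (x α) (hx1 α), inner_self_eq_norm_sq_to_K]
    simpa using hα

theorem midx_iff {k : ℕ} (a b : Fin k → ℕ) :
    MIdxLT a b ↔ toLex ((∑ i, a i), toLex a) < toLex ((∑ i, b i), toLex b) := by
  rw [Prod.Lex.toLex_lt_toLex]
  rfl

theorem midx_wf {k : ℕ} : WellFounded (MIdxLT (k := k)) := by
  have : (MIdxLT (k := k)) = InvImage (· < ·)
      (fun a : Fin k → ℕ => toLex ((∑ i, a i), toLex a)) := by
    ext a b
    exact midx_iff a b
  rw [this]
  exact InvImage.wf _ wellFounded_lt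

theorem midx_tri {k : ℕ} (a b : Fin k → ℕ) (h : a ≠ b) : MIdxLT a b ∨ MIdxLT b a := by
  rw [midx_iff, midx_iff]
  apply lt_or_gt_of_ne
  intro h'
  apply h
  have := congrArg (fun x => (ofLex x).2) h'
  exact this

theorem midx_trans {k : ℕ} (a b c : Fin k → ℕ) (h : MIdxLT a b) (h' : MIdxLT b c) :
    MIdxLT a c := by
  rw [midx_iff] at *
  exact h.trans h'

end HilbertAux

section BergmanSpace

open Metric Filter Topology Set

variable {m : ℕ} {U : Set (Fin m → ℂ)} {γ : (Fin m → ℂ) → ℝ}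

/-- The weighted measure. -/
def wMeas (U : Set (Fin m → ℂ)) (γ : (Fin m → ℂ) → ℝ) : Measure (Fin m → ℂ) :=
  (volume.restrict U).withDensity (fun x => ENNReal.ofReal (γ x))

theorem wMeas_ae (U : Set (Fin m → ℂ)) (γ : (Fin m → ℂ) → ℝ) {p : (Fin m → ℂ) → Prop}
    (h : ∀ᵐ x ∂(volume.restrict U), p x) : ∀ᵐ x ∂(wMeas U γ), p x :=
  (withDensity_absolutelyContinuous _ _).ae_le h

theorem wMeas_aesm (hU : IsOpen U) {f : (Fin m → ℂ) → ℂ} (hf : DifferentiableOn ℂ f U) :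
    AEStronglyMeasurable f (wMeas U γ) :=
  (hf.continuousOn.aestronglyMeasurable hU.measurableSet).mono_ac
    (withDensity_absolutelyContinuous _ _)

theorem wMeas_memLp (hU : IsOpen U) (hw : IsWeight U γ) {f : (Fin m → ℂ) → ℂ}
    (hf : DifferentiableOn ℂ f U) : MemLp f 2 (wMeas U γ) ↔ MemA2 U γ f := by
  rw [memLp_two_iff_integrable_sq_norm (wMeas_aesm hU hf), wMeas,
    integrable_withDensity_iff (by have := hw.1; fun_prop) (by simp)]
  unfold MemA2 IntegrableOn
  simp only [hf, true_and]
  apply integrable_congr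
  filter_upwards [hw.2] with x hx
  rw [ENNReal.toReal_ofReal hx.le]

theorem wMeas_integral (hw : IsWeight U γ) (g : (Fin m → ℂ) → ℂ) :
    ∫ x, g x ∂(wMeas U γ) = ∫ x in U, g x * (γ x : ℂ) := by
  rw [wMeas, integral_withDensity_eq_integral_toReal_smul (by have := hw.1; fun_prop) (by simp)]
  apply integral_congr_ae
  filter_upwards [hw.2] with x hx
  rw [ENNReal.toReal_ofReal hx.le, Complex.real_smul, mul_comm]

/-- The Bergman space. -/
def bergman (U : Set (Fin m → ℂ)) (γ : (Fin m → ℂ) → ℝ) : Submodule ℂ (holSub U) where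
  carrier := {f | MemLp f.1 2 (wMeas U γ)}
  add_mem' := fun hf hg => MemLp.add hf hg
  zero_mem' := MemLp.zero
  smul_mem' := fun c _ hf => MemLp.const_smul hf c

/-- The embedding into `L²`. -/
def toL2 (U : Set (Fin m → ℂ)) (γ : (Fin m → ℂ) → ℝ) :
    bergman U γ →ₗ[ℂ] Lp ℂ 2 (wMeas U γ) where
  toFun f := MemLp.toLp f.1.1 f.2
  map_add' _ _ := rfl
  map_smul' _ _ := rfl

theorem toL2_inner (hw : IsWeight U γ) (f g : bergman U γ) :
    inner ℂ (toL2 U γ f) (toL2 U γ g) = innerA2 U γ g.1.1 f.1.1 := by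
  rw [L2.inner_def, innerA2, ← wMeas_integral hw (fun x => g.1.1 x * (starRingEnd ℂ) (f.1.1 x))]
  apply integral_congr_ae
  filter_upwards [MemLp.coeFn_toLp f.2, MemLp.coeFn_toLp g.2] with x hf hg
  change inner ℂ ((MemLp.toLp f.1.1 f.2 : (Fin m → ℂ) → ℂ) x)
    ((MemLp.toLp g.1.1 g.2 : (Fin m → ℂ) → ℂ) x) = _
  rw [hf, hg]
  rfl

theorem toL2_norm (hw : IsWeight U γ) (f : bergman U γ) :
    normSqA2 U γ f.1.1 = ‖toL2 U γ f‖ ^ 2 := by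
  have h1 := toL2_inner hw f f
  rw [inner_self_eq_norm_sq_to_K] at h1
  have h2 : innerA2 U γ f.1.1 f.1.1 = ((normSqA2 U γ f.1.1 : ℝ) : ℂ) := by
    unfold innerA2 normSqA2
    rw [← integral_complex_ofReal]
    congr 1
    ext x
    rw [Complex.mul_conj, Complex.normSq_eq_norm_sq]
    push_cast
    rfl
  rw [h2] at h1
  have h3 : ((‖toL2 U γ f‖ ^ 2 : ℝ) : ℂ) = ((normSqA2 U γ f.1.1 : ℝ) : ℂ) := by
    rw [← h1]; push_cast; rfl
  exact (Complex.ofReal_injective h3).symm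

/-- Local boundedness of an operator. -/
def OpBdd (U : Set (Fin m → ℂ)) (γ : (Fin m → ℂ) → ℝ) (T : Module.End ℂ (holSub U)) : Prop :=
  ∀ K : Set (Fin m → ℂ), K ⊆ U → IsCompact K → ∃ C : ℝ, 0 ≤ C ∧ ∀ f : bergman U γ,
    ∀ z ∈ K, ‖(T f.1).1 z‖ ≤ C * ‖toL2 U γ f‖

theorem opBdd_one (hU : IsOpen U) (hw : IsWeight U γ) (he : EvalBound U γ) : OpBdd U γ 1 := by
  intro K hK hKc
  obtain ⟨C, hC⟩ := he K hK hKc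
  refine ⟨√|C|, Real.sqrt_nonneg _, fun f z hz => ?_⟩
  have h1 := hC f.1.1 ((wMeas_memLp hU hw f.1.2.1).mp f.2) z hz
  rw [toL2_norm hw] at h1
  rw [Module.End.one_apply]
  apply le_of_sq_le_sq _ (by positivity)
  rw [mul_pow, Real.sq_sqrt (abs_nonneg C)]
  refine h1.trans ?_
  gcongr
  exact le_abs_self C

theorem opBdd_dirOp (hU : IsOpen U) {T : Module.End ℂ (holSub U)} (hT : OpBdd U γ T)
    (v : Fin m → ℂ) : OpBdd U γ (dirOp hU v * T) := by
  intro K hK hKc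
  obtain ⟨δ, hδ, hδU⟩ := hKc.exists_cthickening_subset_open hU hK
  obtain ⟨C, hC0, hC⟩ := hT _ hδU hKc.cthickening
  refine ⟨C / δ * ‖v‖, by positivity, fun f z hz => ?_⟩
  have hsub : closedBall z δ ⊆ cthickening δ K := closedBall_subset_cthickening hz δ
  have h1 := aux_fderiv_bound hU (T f.1).2.1 hδ (hsub.trans hδU) fun w hw => hC f w (hsub hw)
  rw [Module.End.mul_apply, dirOp_apply hU _ _ (hK hz)]
  calc _ ≤ ‖fderiv ℂ (T f.1).1 z‖ * ‖v‖ := ContinuousLinearMap.le_opNorm _ _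
    _ ≤ (C * ‖toL2 U γ f‖ / δ) * ‖v‖ := by gcongr
    _ = _ := by ring

theorem opBdd_dirOp_pow (hU : IsOpen U) {T : Module.End ℂ (holSub U)} (hT : OpBdd U γ T)
    (v : Fin m → ℂ) (n : ℕ) : OpBdd U γ (dirOp hU v ^ n * T) := by
  induction n with
  | zero => simpa using hT
  | succ n ih =>
    rw [pow_succ', mul_assoc]
    exact opBdd_dirOp hU ih v

theorem opBdd_mOp (hU : IsOpen U) (hw : IsWeight U γ) (he : EvalBound U γ) (β : Fin m → ℕ) :
    OpBdd U γ (mOp hU β) := by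
  unfold mOp
  generalize List.finRange m = l
  induction l with
  | nil => simpa using opBdd_one hU hw he
  | cons j l ih =>
    rw [List.map_cons, List.prod_cons]
    exact opBdd_dirOp_pow hU ih _ _

theorem toL2_injective (hU : IsOpen U) (hw : IsWeight U γ) (he : EvalBound U γ) :
    Function.Injective (toL2 U γ) := by
  rw [injective_iff_map_eq_zero]
  intro f hf
  apply Subtype.ext
  apply holSub_ext
  intro z hz
  obtain ⟨C, _, hC⟩ := opBdd_one hU hw he {z} (by simpa using hz) isCompact_singleton
  have := hC f z rfl
  rw [hf, norm_zero, mul_zero] at this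
  simpa using this

theorem toL2_range_closed (hU : IsOpen U) (hw : IsWeight U γ) (he : EvalBound U γ) :
    IsClosed ((toL2 U γ).range : Set (Lp ℂ 2 (wMeas U γ))) := by
  apply IsSeqClosed.isClosed
  intro u F hu hF
  choose f hf using hu
  have hcau : CauchySeq u := hF.cauchySeq
  have hunif : ∀ K ⊆ U, IsCompact K →
      UniformCauchySeqOn (fun n => (f n).1.1) atTop K := by
    intro K hK hKc
    obtain ⟨C, hC0, hC⟩ := opBdd_one hU hw he K hK hKc
    rw [Metric.uniformCauchySeqOn_iff]
    intro ε hε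
    rw [Metric.cauchySeq_iff] at hcau
    obtain ⟨N, hN⟩ := hcau (ε / (C + 1)) (by positivity)
    refine ⟨N, fun n hn k hk x hx => ?_⟩
    have h1 := hC (f n - f k) x hx
    have h1' : toL2 U γ (f n - f k) = u n - u k := by
      rw [← hf n, ← hf k]
      exact (toL2 U γ).map_sub (f n) (f k)
    rw [h1'] at h1
    have h2 := hN n hn k hk
    rw [dist_eq_norm] at h2 ⊢
    rw [lt_div_iff₀ (by positivity)] at h2
    have h3 : ‖(f n).1.1 x - (f k).1.1 x‖ ≤ C * ‖u n - u k‖ := h1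
    nlinarith [norm_nonneg (u n - u k)]
  have hlim : ∀ x, ∃ L, Tendsto (fun n => (f n).1.1 x) atTop (𝓝 L) := by
    intro x
    by_cases hx : x ∈ U
    · exact cauchySeq_tendsto_of_complete
        ((hunif {x} (by simpa using hx) isCompact_singleton).cauchySeq rfl)
    · refine ⟨0, ?_⟩
      simp only [(f _).1.2.2 x hx]
      exact tendsto_const_nhds
  choose g hg using hlim
  have hgd : DifferentiableOn ℂ g U := aux_limit hU (fun n => (f n).1.2.1) fun K hK hKc =>
    (hunif K hK hKc).tendstoUniformlyOn_of_tendsto fun x _ => hg x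
  have hg0 : ∀ x, x ∉ U → g x = 0 := by
    intro x hx
    have := hg x
    simp only [(f _).1.2.2 x hx] at this
    exact tendsto_nhds_unique this tendsto_const_nhds
  have hae : F =ᵐ[wMeas U γ] g := by
    obtain ⟨φ, hφ, hφ'⟩ := (tendstoInMeasure_of_tendsto_Lp hF).exists_seq_tendsto_ae
    have hall : ∀ᵐ x ∂(wMeas U γ), ∀ n, u n x = (f n).1.1 x := by
      rw [ae_all_iff]
      intro n
      rw [← hf n]
      exact MemLp.coeFn_toLp (f n).2
    filter_upwards [hφ', hall] with x hx hx'
    simp only [hx'] at hx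
    exact tendsto_nhds_unique hx ((hg x).comp hφ.tendsto_atTop)
  have hgL : MemLp g 2 (wMeas U γ) := (memLp_congr_ae hae).mp (Lp.memLp F)
  refine ⟨⟨⟨g, hgd, hg0⟩, hgL⟩, ?_⟩
  apply Lp.ext
  exact (MemLp.coeFn_toLp hgL).trans hae.symm

end BergmanSpace



/-- `A²(U,γ)` admits a complete orthonormal basis `(f_α)_{α∈S₂}`, indexed by a
set `S₂` of multi-indices, such that `ord_{u₀}(f_α) = α` for every `α ∈ S₂`. -/
theorem exists_orthonormal_basis_with_orders {m : ℕ}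
    (U : Set (Fin m → ℂ)) (hUo : IsOpen U) (hUc : IsConnected U)
    (u₀ : Fin m → ℂ) (hu₀ : u₀ ∈ U)
    (γ : (Fin m → ℂ) → ℝ) (hw : IsWeight U γ) (he : EvalBound U γ) :
    ∃ (S₂ : Set (Fin m → ℕ)) (f : (Fin m → ℕ) → (Fin m → ℂ) → ℂ),
      (∀ α ∈ S₂, MemA2 U γ (f α)) ∧
      (∀ α ∈ S₂, ∀ β ∈ S₂, innerA2 U γ (f α) (f β) = if α = β then 1 else 0) ∧
      (∀ g : (Fin m → ℂ) → ℂ, MemA2 U γ g →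
        (∀ α ∈ S₂, innerA2 U γ g (f α) = 0) → ∀ u ∈ U, g u = 0) ∧
      (∀ α ∈ S₂, multiDeriv α (f α) u₀ ≠ 0 ∧
        ∀ β, MIdxLT β α → multiDeriv β (f α) u₀ = 0) := by
  classical
  have hcl := toL2_range_closed hUo hw he
  have hinj := toL2_injective hUo hw he
  let W := (toL2 U γ).range
  have : CompleteSpace W := hcl.completeSpace_coe
  let e : bergman U γ ≃ₗ[ℂ] W := LinearEquiv.ofInjective (toL2 U γ) hinj
  have hev : ∀ x : W, toL2 U γ (e.symm x) = x.1 := fun x =>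
    congrArg Subtype.val (e.apply_symm_apply x)
  have hL : ∀ β : Fin m → ℕ, ∃ L : W →L[ℂ] ℂ, ∀ x, L x = (mOp hUo β (e.symm x).1).1 u₀ := by
    intro β
    obtain ⟨C, _, hC⟩ := opBdd_mOp hUo hw he β {u₀} (by simpa using hu₀) isCompact_singleton
    let l : W →ₗ[ℂ] ℂ :=
      { toFun := fun x => (mOp hUo β (e.symm x).1).1 u₀
        map_add' := fun x y => by simp
        map_smul' := fun c x => by simp }
    refine ⟨l.mkContinuous C fun x => ?_, fun x => rfl⟩
    have := hC (e.symm x) u₀ rfl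
    rw [hev] at this
    exact this
  choose L hL using hL
  obtain ⟨S, f, h1, h2, h3⟩ := hilbert_aux (MIdxLT (k := m)) midx_wf midx_tri midx_trans L (by
    intro x hx
    have : (e.symm x).1 = 0 := allZero_eq_zero hUo hUc.isPreconnected hu₀ (fun β => by
      rw [← hL]; exact hx β)
    have h0 : e.symm x = 0 := Subtype.ext this
    simpa using h0)
  have hinner : ∀ x y : W, inner ℂ x y = innerA2 U γ (e.symm y).1.1 (e.symm x).1.1 := by
    intro x y
    rw [← toL2_inner hw, hev, hev, Submodule.coe_inner]
  refine ⟨S, fun α => (e.symm (f α)).1.1, ?_, ?_, ?_, ?_⟩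
  · intro α _
    exact (wMeas_memLp hUo hw (e.symm (f α)).1.2.1).mp (e.symm (f α)).2
  · intro α hα β hβ
    rw [← hinner, h1 β hβ α hα]
    simp only [eq_comm]
  · intro g hg hg0 u hu
    have hgU : ∀ x ∈ U, (holMk g hg.1).1 x = g x := fun x hx => holMk_apply g hg.1 hx
    have hmem : MemLp (holMk g hg.1).1 2 (wMeas U γ) := by
      rw [wMeas_memLp hUo hw (holMk g hg.1).2.1]
      refine ⟨(holMk g hg.1).2.1, hg.2.congr_fun (fun x hx => ?_) hUo.measurableSet⟩
      simp only [hgU x hx]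
    have h4 := h2 (e ⟨holMk g hg.1, hmem⟩) (fun α hα => by
      rw [hinner, e.symm_apply_apply, ← hg0 α hα]
      apply setIntegral_congr_fun hUo.measurableSet
      intro x hx
      simp only [hgU x hx])
    rw [LinearEquiv.map_eq_zero_iff] at h4
    have h5 : (holMk g hg.1) = 0 := congrArg Subtype.val h4
    rw [← hgU u hu, h5]
    rfl
  · intro α hα
    obtain ⟨h4, h5⟩ := h3 α hα
    rw [hL] at h4
    refine ⟨?_, fun β hβ => ?_⟩
    · rw [mOp_apply hUo α _ (e.symm (f α)).1 (fun _ _ => rfl) hu₀]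
      exact h4
    · rw [mOp_apply hUo β _ (e.symm (f α)).1 (fun _ _ => rfl) hu₀, ← hL]
      exact h5 β hβ
end
end
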